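/- Let d, φ, β be real numbers with 0 ≤ d ≤ 1, 0 ≤ φ ≤ (1−d)/2, and 0 ≤ β ≤ d + φ. Define sequences δ, λ: {1,2,3,…} → ℝ by δ_1 = d, λ_1 = φ − β + d, and for k ≥ 2, δ_k = ((k−1−d)/k)·δ_{k−1} and λ_k = β·λ_{k−1} + δ_k − φ·δ_{k−1}. Then λ_k ≥ 0 for every k ≥ 1. -/

import Mathlib

/-- Under the FIGARCH(1,d,1) constraints `0 ≤ d ≤ 1`, `0 ≤ φ ≤ (1-d)/2`,
`0 ≤ β ≤ d + φ`, the ARCH(∞) coefficients `λ k` defined by `δ 1 = d`,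
`λ 1 = φ - β + d`, `δ k = ((k-1-d)/k) δ (k-1)`, and
`λ k = β λ (k-1) + δ k - φ δ (k-1)` for `k ≥ 2`, are nonnegative for all
`k ≥ 1`. -/
theorem figarch_lambda_nonneg
    (d φ β : ℝ)
    (hd0 : 0 ≤ d) (hd1 : d ≤ 1)
    (hφ0 : 0 ≤ φ) (hφ1 : φ ≤ (1 - d) / 2)
    (hβ0 : 0 ≤ β) (hβ1 : β ≤ d + φ)
    (δ lam : ℕ → ℝ)
    (hδ1 : δ 1 = d) (hlam1 : lam 1 = φ - β + d)
    (hδ : ∀ k : ℕ, 2 ≤ k → δ k = (((k : ℝ) - 1 - d) / k) * δ (k - 1))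
    (hlam : ∀ k : ℕ, 2 ≤ k → lam k = β * lam (k - 1) + δ k - φ * δ (k - 1)) :
    ∀ k : ℕ, 1 ≤ k → 0 ≤ lam k := by
  have ratio : ∀ k : ℕ, 2 ≤ k → (1 - d) / 2 ≤ ((k : ℝ) - 1 - d) / k := by
    intro k hk
    have hk' : (2 : ℝ) ≤ k := by exact_mod_cast hk
    rw [div_le_div_iff₀ (by norm_num) (by linarith)]
    nlinarith
  have δ_nonneg : ∀ k : ℕ, 1 ≤ k → 0 ≤ δ k := by
    intro k hk
    induction k, hk using Nat.le_induction with
    | base => rwa [hδ1]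
    | succ n hn ih =>
      rw [hδ (n + 1) (by omega), Nat.add_sub_cancel]
      exact mul_nonneg (by linarith [ratio (n + 1) (by omega)]) ih
  intro k hk
  induction k, hk using Nat.le_induction with
  | base => linarith
  | succ n hn ih =>
    rw [hlam (n + 1) (by omega), hδ (n + 1) (by omega), Nat.add_sub_cancel, add_sub_assoc,
      ← sub_mul]
    exact add_nonneg (mul_nonneg hβ0 ih)
      (mul_nonneg (by linarith [ratio (n + 1) (by omega)]) (δ_nonneg n hn))
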